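/- The sequence P(1), P(2), P(3), ... is weakly decreasing; that is, for every integer n >= 1, P(n+1) <= P(n). -/

import Mathlib

namespace BalancedTrees

/-- Plane binary trees with vertices labeled by natural numbers;
`nil` is the empty tree, and each child of a vertex is designated
as a left child or a right child. -/
inductive BT where
  | nil : BT
  | node (label : ℕ) (l r : BT) : BT
deriving DecidableEq

namespace BT

/-- `balRank t = some k` if and only if the root of `t` is a balanced vertex of
rank `k`, i.e. every descending path from the root to a leaf has length `k`. -/
def balRank : BT → Option ℕ
  | .nil => none
  | .node _ .nil .nil => some 0
  | .node _ .nil (.node b rl rr) => (balRank (BT.node b rl rr)).map (· + 1)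
  | .node _ (.node a ll lr) .nil => (balRank (BT.node a ll lr)).map (· + 1)
  | .node _ (.node a ll lr) (.node b rl rr) =>
      match balRank (BT.node a ll lr), balRank (BT.node b rl rr) with
      | some i, some j => if i = j then some (i + 1) else none
      | _, _ => none

/-- The number of balanced vertices of rank `k` in the tree `t`. -/
def countBal (k : ℕ) : BT → ℕ
  | .nil => 0
  | .node v l r =>
      countBal k l + countBal k r +
        (if balRank (BT.node v l r) = some k then 1 else 0)

/-- The number of balanced vertices (of any rank) in the tree `t`. -/
def countBalAll : BT → ℕ
  | .nil => 0
  | .node v l r =>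
      countBalAll l + countBalAll r +
        (if (balRank (BT.node v l r)).isSome then 1 else 0)

/-- Auxiliary, fuelled version of `treeOf`. -/
def treeOfAux : ℕ → List ℕ → BT
  | 0, _ => .nil
  | _ + 1, [] => .nil
  | fuel + 1, l =>
      let m := l.foldr max 0
      BT.node m (treeOfAux fuel (l.takeWhile (· != m)))
                (treeOfAux fuel ((l.dropWhile (· != m)).tail))

/-- The decreasing binary tree `T(π)` of a sequence `π` of distinct labels:
the root is the maximum entry, and its left (resp. right) subtree is built
recursively from the part of the sequence to the left (resp. right) of the
maximum. This is a bijection between permutations of `{1,…,n}` and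
decreasing binary trees on `{1,…,n}`. -/
def treeOf (l : List ℕ) : BT := treeOfAux l.length l

/-- Canonical form for non-plane 1-2 trees (as represented by plane trees):
an only child is stored as a left child, and of two (unordered) children the
one with the larger label is stored on the left. Decreasing binary trees in
canonical form are in bijection with non-plane 1-2 trees. -/
def canonNP : BT → Bool
  | .nil => true
  | .node _ l r =>
      canonNP l && canonNP r &&
        (match l, r with
         | .nil, .nil => true
         | .node _ _ _, .nil => true
         | .nil, .node _ _ _ => false
         | .node a _ _, .node b _ _ => decide (b < a))

/-- Canonical form for plane 1-2 trees: an only child is stored as a left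
child (an only child carries no left/right designation), while two children
remain ordered. Decreasing binary trees in canonical form are in bijection
with plane 1-2 trees. -/
def canonP : BT → Bool
  | .nil => true
  | .node _ l r =>
      canonP l && canonP r &&
        (match l, r with
         | .nil, .node _ _ _ => false
         | _, _ => true)

end BT

open BT

/-- The list of all permutations of `{1,…,n}`, each written as a list. -/
def perms (n : ℕ) : List (List ℕ) := (List.range' 1 n).permutations

/-- `a n k`: the total number of balanced vertices of rank `k` over all
decreasing binary trees on `{1,…,n}`. -/
def a (n k : ℕ) : ℕ := ((perms n).map fun l => countBal k (treeOf l)).sum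

/-- `r n k`: the number of decreasing binary trees on `{1,…,n}` whose root is
balanced of rank `k`. -/
def r (n k : ℕ) : ℕ :=
  ((perms n).filter fun l => decide (balRank (treeOf l) = some k)).length

/-- `p n k`: the probability that the root of a uniformly random decreasing
binary tree on `{1,…,n}` is balanced of rank `k`; by convention `p 0 k = 1`. -/
def p (n k : ℕ) : ℚ := if n = 0 then 1 else (r n k : ℚ) / (Nat.factorial n : ℚ)

/-- The number of decreasing binary trees on `{1,…,n}` whose root is balanced. -/
def rootBal (n : ℕ) : ℕ :=
  ((perms n).filter fun l => (balRank (treeOf l)).isSome).length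

/-- `proot n`: the probability that the root of a uniformly random decreasing
binary tree on `{1,…,n}` is balanced. -/
def proot (n : ℕ) : ℚ := (rootBal n : ℚ) / (Nat.factorial n : ℚ)

/-- The total number of balanced vertices over all decreasing binary trees
on `{1,…,n}`. -/
def totalBal (n : ℕ) : ℕ := ((perms n).map fun l => countBalAll (treeOf l)).sum

/-- `Pbal n`: the probability that a vertex chosen uniformly at random from
the `n * n!` vertices of all decreasing binary trees on `{1,…,n}` is balanced. -/
def Pbal (n : ℕ) : ℚ := (totalBal n : ℚ) / ((n : ℚ) * (Nat.factorial n : ℚ))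

/-- Permutations whose decreasing binary tree is a canonical representative
of a non-plane 1-2 tree; these are in bijection with non-plane 1-2 trees
on `{1,…,n}`. -/
def npPerms (n : ℕ) : List (List ℕ) := (perms n).filter fun l => canonNP (treeOf l)

/-- `E n`: the number of non-plane 1-2 trees on `{1,…,n}` (the Euler number). -/
def E (n : ℕ) : ℕ := (npPerms n).length

/-- `b n k`: the total number of balanced vertices of rank `k` over all
non-plane 1-2 trees on `{1,…,n}`. -/
def b (n k : ℕ) : ℕ := ((npPerms n).map fun l => countBal k (treeOf l)).sum

/-- `s n k`: the number of non-plane 1-2 trees on `{1,…,n}` whose root is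
balanced of rank `k`. -/
def s (n k : ℕ) : ℕ :=
  ((npPerms n).filter fun l => decide (balRank (treeOf l) = some k)).length

/-- Permutations whose decreasing binary tree is a canonical representative
of a plane 1-2 tree; these are in bijection with plane 1-2 trees on `{1,…,n}`. -/
def pPerms (n : ℕ) : List (List ℕ) := (perms n).filter fun l => canonP (treeOf l)

/-- `z n`: the number of plane 1-2 trees on `{1,…,n}`. -/
def z (n : ℕ) : ℕ := (pPerms n).length

/-- `d n k`: the total number of balanced vertices of rank `k` over all
plane 1-2 trees on `{1,…,n}`. -/
def d (n k : ℕ) : ℕ := ((pPerms n).map fun l => countBal k (treeOf l)).sum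

/-- `t n k`: the number of plane 1-2 trees on `{1,…,n}` whose root is
balanced of rank `k`. -/
def t (n k : ℕ) : ℕ :=
  ((pPerms n).filter fun l => decide (balRank (treeOf l) = some k)).length

end BalancedTrees

open BalancedTrees

namespace BalancedTrees

open BT

theorem foldr_max_mem : ∀ l : List ℕ, l ≠ [] → l.foldr max 0 ∈ l
  | [], h => absurd rfl h
  | [x], _ => by simp
  | x :: y :: l, _ => by
    have ih := foldr_max_mem (y :: l) (by simp)
    rw [List.foldr_cons]
    rcases max_choice x ((y :: l).foldr max 0) with h | h
    · rw [h]; exact List.mem_cons_self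
    · rw [h]; exact List.mem_cons_of_mem _ ih

theorem length_takeWhile_ne_lt {m : ℕ} {l : List ℕ} (hm : m ∈ l) :
    (l.takeWhile (· != m)).length < l.length := by
  induction l with
  | nil => simp at hm
  | cons x l ih =>
    by_cases hx : x = m
    · simp [hx]
    · have hml : m ∈ l := by simpa [Ne.symm hx] using hm
      simpa [List.takeWhile_cons, hx] using ih hml

theorem length_tail_dropWhile_ne_lt {m : ℕ} {l : List ℕ} (hm : m ∈ l) :
    (l.dropWhile (· != m)).tail.length < l.length := by
  have h1 : (l.dropWhile (· != m)).length ≤ l.length := List.length_dropWhile_le _ _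
  have h2 : 0 < l.length := List.length_pos_of_mem hm
  rw [List.length_tail]
  omega

theorem treeOfAux_eq_of_length_le (f : ℕ) : ∀ (g : ℕ) (l : List ℕ), l.length ≤ f → l.length ≤ g →
    treeOfAux f l = treeOfAux g l := by
  induction f with
  | zero =>
    intro g l hf _
    obtain rfl : l = [] := by simpa using hf
    cases g <;> rfl
  | succ f ih =>
    intro g l hf hg
    cases l with
    | nil => cases g <;> rfl
    | cons x l =>
      cases g with
      | zero => simp at hg
      | succ g =>
        have hm := foldr_max_mem (x :: l) (by simp)
        have h1 := length_takeWhile_ne_lt hm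
        have h2 := length_tail_dropWhile_ne_lt hm
        simp only [treeOfAux]
        rw [ih g _ (by omega) (by omega), ih g _ (by omega) (by omega)]

theorem foldr_max_eq {l : List ℕ} {m : ℕ} (hm : m ∈ l) (h : ∀ x ∈ l, x ≤ m) :
    l.foldr max 0 = m :=
  le_antisymm (h _ (foldr_max_mem l (List.ne_nil_of_mem hm)))
    (List.le_max_of_le hm le_rfl)

theorem treeOf_append_cons {l₁ l₂ : List ℕ} {m : ℕ} (h₁ : ∀ x ∈ l₁, x < m)
    (h₂ : ∀ x ∈ l₂, x < m) :
    treeOf (l₁ ++ m :: l₂) = BT.node m (treeOf l₁) (treeOf l₂) := by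
  have hmax : (l₁ ++ m :: l₂).foldr max 0 = m := by
    refine foldr_max_eq (by simp) fun x hx => ?_
    rcases List.mem_append.1 hx with hx | hx
    · exact (h₁ x hx).le
    · rcases List.mem_cons.1 hx with rfl | hx
      · exact le_rfl
      · exact (h₂ x hx).le
  have hne : ∀ x ∈ l₁, (x != m) = true := fun x hx => by simpa using (h₁ x hx).ne
  have htake : (l₁ ++ m :: l₂).takeWhile (· != m) = l₁ := by
    rw [List.takeWhile_append_of_pos hne]; simp
  have hdrop : (l₁ ++ m :: l₂).dropWhile (· != m) = m :: l₂ := by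
    rw [List.dropWhile_append_of_pos hne]; simp
  obtain ⟨f, hf⟩ : ∃ f, (l₁ ++ m :: l₂).length = f + 1 := ⟨l₁.length + l₂.length, by simp; omega⟩
  have hf' : l₁.length + l₂.length = f := by simp at hf; omega
  obtain ⟨x, l, hl⟩ : ∃ x l, l₁ ++ m :: l₂ = x :: l := by
    cases l₁ <;> simp
  have hstep : treeOf (l₁ ++ m :: l₂) = BT.node m (treeOfAux f l₁) (treeOfAux f l₂) := by
    rw [treeOf, hf]
    rw [hl] at hmax htake hdrop ⊢
    simp only [treeOfAux, hmax, htake, hdrop, List.tail_cons]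
  rw [hstep, treeOfAux_eq_of_length_le f l₁.length l₁ (by omega) le_rfl,
    treeOfAux_eq_of_length_le f l₂.length l₂ (by omega) le_rfl]
  rfl

theorem treeOf_eq_nil_iff {l : List ℕ} : treeOf l = BT.nil ↔ l = [] := by
  cases l <;> simp [treeOf, treeOfAux]

/-- The tree is empty or its root is balanced of rank `k`. -/
def emptyOrBal (k : ℕ) (t : BT) : Prop := t = BT.nil ∨ balRank t = some k

instance (k : ℕ) (t : BT) : Decidable (emptyOrBal k t) := by unfold emptyOrBal; infer_instance

theorem balRank_node_succ {v k : ℕ} {l r : BT} : balRank (BT.node v l r) = some (k + 1) ↔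
    emptyOrBal k l ∧ emptyOrBal k r ∧ ¬ (l = BT.nil ∧ r = BT.nil) := by
  cases l <;> cases r <;> simp only [balRank, emptyOrBal] <;> try simp
  split <;> simp_all

theorem balRank_node_zero {v : ℕ} {l r : BT} : balRank (BT.node v l r) = some 0 ↔
    l = BT.nil ∧ r = BT.nil := by
  cases l <;> cases r <;> simp only [balRank] <;> try simp
  split <;> simp

theorem balRank_treeOfAux_lt (f : ℕ) : ∀ (l : List ℕ) (k : ℕ),
    balRank (treeOfAux f l) = some k → k < f := by
  induction f with
  | zero => intro l k h; simp [treeOfAux, balRank] at h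
  | succ f ih =>
    intro l k h
    cases l with
    | nil => simp [treeOfAux, balRank] at h
    | cons x l =>
      cases k with
      | zero => omega
      | succ k =>
        simp only [treeOfAux] at h
        obtain ⟨h1, h2, h3⟩ := balRank_node_succ.1 h
        rcases h1 with h1 | h1
        · rcases h2 with h2 | h2
          · exact absurd ⟨h1, h2⟩ h3
          · have := ih _ _ h2; omega
        · have := ih _ _ h1; omega

/-- All orderings of the finite set `s`. -/
noncomputable def orderings (s : Finset ℕ) : Finset (List ℕ) := s.toList.permutations.toFinset

/-- The sum of `F` over all orderings of the finite set `s`. -/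
noncomputable def permSum (s : Finset ℕ) (F : List ℕ → ℕ) : ℕ := ∑ l ∈ orderings s, F l

theorem mem_orderings {s : Finset ℕ} {l : List ℕ} : l ∈ orderings s ↔ s.val = l := by
  rw [orderings, List.mem_toFinset, List.mem_permutations, ← Finset.coe_toList s,
    Multiset.coe_eq_coe]
  exact List.perm_comm

theorem mem_of_mem_orderings {s : Finset ℕ} {l : List ℕ} (h : l ∈ orderings s) {x : ℕ} :
    x ∈ l ↔ x ∈ s := by
  rw [mem_orderings] at h
  rw [← Finset.mem_val, h, Multiset.mem_coe]

theorem length_of_mem_orderings {s : Finset ℕ} {l : List ℕ} (h : l ∈ orderings s) :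
    l.length = s.card := by
  rw [mem_orderings] at h
  rw [Finset.card_def, h, Multiset.coe_card]

theorem permSum_empty (F : List ℕ → ℕ) : permSum ∅ F = F [] := by
  have : orderings (∅ : Finset ℕ) = {[]} := by
    ext l
    rw [mem_orderings, Finset.mem_singleton, Finset.empty_val, eq_comm, Multiset.coe_eq_zero]
  rw [permSum, this, Finset.sum_singleton]

theorem permSum_insert {s : Finset ℕ} {m : ℕ} (hm : m ∉ s) (F : List ℕ → ℕ) :
    permSum (insert m s) F =
      ∑ t ∈ s.powerset, permSum t fun l₁ => permSum (s \ t) fun l₂ => F (l₁ ++ m :: l₂) := by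
  unfold permSum
  simp_rw [← Finset.sum_product']
  rw [Finset.sum_sigma']
  symm
  refine Finset.sum_bij (fun x _ => x.2.1 ++ m :: x.2.2) ?_ ?_ ?_ (fun _ _ => rfl)
  · rintro ⟨t, l₁, l₂⟩ hx
    simp only [Finset.mem_sigma, Finset.mem_powerset, Finset.mem_product, mem_orderings] at hx ⊢
    obtain ⟨ht, h1, h2⟩ := hx
    rw [Finset.insert_val_of_notMem hm, Multiset.coe_eq_coe.2 List.perm_middle,
      ← Multiset.cons_coe, ← Multiset.coe_add, ← h1, ← h2]
    rw [Finset.sdiff_val, add_tsub_cancel_of_le (Finset.val_le_iff.2 ht)]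
  · rintro ⟨t, l₁, l₂⟩ hx ⟨t', l₁', l₂'⟩ hx' h
    simp only [Finset.mem_sigma, Finset.mem_powerset, Finset.mem_product] at hx hx' h
    have n1 : m ∉ l₁ := fun h => hm (hx.1 ((mem_of_mem_orderings hx.2.1).1 h))
    have n2 : m ∉ l₂ := fun h => hm (Finset.sdiff_subset ((mem_of_mem_orderings hx.2.2).1 h))
    obtain ⟨rfl, -, rfl⟩ := (List.append_cons_inj_of_notMem n1 n2).1 h
    have : t = t' := Finset.val_injective
      ((mem_orderings.1 hx.2.1).trans (mem_orderings.1 hx'.2.1).symm)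
    rw [this]
  · intro l hl
    have hml : m ∈ l := (mem_of_mem_orderings hl).2 (Finset.mem_insert_self _ _)
    obtain ⟨l₁, l₂, rfl⟩ := List.append_of_mem hml
    rw [mem_orderings] at hl
    have hnd : (l₁ ++ m :: l₂).Nodup := by
      rw [← Multiset.coe_nodup, ← hl]; exact Finset.nodup _
    have hval : s.val = (l₁ : Multiset ℕ) + l₂ := by
      rw [Finset.insert_val_of_notMem hm, ← Multiset.coe_eq_coe.2 List.perm_middle.symm,
        ← Multiset.cons_coe, Multiset.cons_inj_right] at hl
      rw [hl, Multiset.coe_add]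
    have hnd1 : (l₁ : Multiset ℕ).Nodup := (List.nodup_append.1 hnd).1
    have hsd : (s \ ⟨(l₁ : Multiset ℕ), hnd1⟩).val = l₂ := by
      rw [Finset.sdiff_val, hval]; exact add_tsub_cancel_left _ _
    refine ⟨⟨⟨(l₁ : Multiset ℕ), hnd1⟩, l₁, l₂⟩, ?_, rfl⟩
    simp only [Finset.mem_sigma, Finset.mem_powerset, Finset.mem_product, mem_orderings]
    refine ⟨?_, trivial, hsd⟩
    rw [← Finset.val_le_iff, hval]
    exact Multiset.le_add_right _ _

theorem permSum_congr {s : Finset ℕ} {F G : List ℕ → ℕ} (h : ∀ l ∈ orderings s, F l = G l) :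
    permSum s F = permSum s G := Finset.sum_congr rfl h

theorem permSum_one (s : Finset ℕ) : permSum s (fun _ => 1) = s.card.factorial := by
  rw [permSum, Finset.sum_const, smul_eq_mul, mul_one]
  rw [orderings, List.toFinset_card_of_nodup (List.nodup_permutations _ s.nodup_toList),
    List.length_permutations, Finset.length_toList]

theorem sum_map_perms (n : ℕ) (F : List ℕ → ℕ) :
    ((perms n).map F).sum = permSum (Finset.Icc 1 n) F := by
  have hnd : (perms n).Nodup := List.nodup_permutations _ List.nodup_range'
  rw [← List.sum_toFinset _ hnd, permSum]
  refine Finset.sum_congr ?_ fun _ _ => rfl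
  ext l
  have h : (Finset.Icc 1 n).val = (List.range' 1 n : Multiset ℕ) := rfl
  rw [mem_orderings, h, List.mem_toFinset, perms, List.mem_permutations, Multiset.coe_eq_coe]
  exact List.perm_comm

theorem permSum_mul {s t : Finset ℕ} (F G : List ℕ → ℕ) :
    permSum s (fun l₁ => permSum t fun l₂ => F l₁ * G l₂) = permSum s F * permSum t G := by
  unfold permSum
  rw [Finset.sum_mul_sum]

theorem permSum_add {s : Finset ℕ} (F G : List ℕ → ℕ) :
    permSum s (fun l => F l + G l) = permSum s F + permSum s G :=
  Finset.sum_add_distrib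

/-- The number of decreasing binary trees on `n` labels which are empty or whose root is balanced
of rank `k`. -/
def emptyOrBalCount : ℕ → ℕ → ℕ
  | _, 0 => 1
  | 0, n + 1 => if n = 0 then 1 else 0
  | k + 1, n + 1 => if n = 0 then 0 else
      ∑ i ∈ Finset.range (n + 1), n.choose i * emptyOrBalCount k i * emptyOrBalCount k (n - i)

theorem exists_eq_insert_max {s : Finset ℕ} {n : ℕ} (hs : s.card = n + 1) :
    ∃ (m : ℕ) (u : Finset ℕ), m ∉ u ∧ s = insert m u ∧ u.card = n ∧ ∀ x ∈ u, x < m := by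
  have hne : s.Nonempty := Finset.card_pos.1 (by omega)
  refine ⟨s.max' hne, s.erase (s.max' hne), Finset.notMem_erase _ _,
    (Finset.insert_erase (s.max'_mem hne)).symm, ?_, fun x hx => ?_⟩
  · rw [Finset.card_erase_of_mem (s.max'_mem hne), hs]; rfl
  · exact s.lt_max'_of_mem_erase_max' hne hx

/-- Splitting a sum over trees at the root. -/
theorem permSum_treeOf_insert {u : Finset ℕ} {m : ℕ} (hm : m ∉ u) (hlt : ∀ x ∈ u, x < m)
    (F : BT → ℕ) :
    permSum (insert m u) (fun l => F (treeOf l)) = ∑ t ∈ u.powerset, permSum t fun l₁ =>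
      permSum (u \ t) fun l₂ => F (BT.node m (treeOf l₁) (treeOf l₂)) := by
  rw [permSum_insert hm]
  refine Finset.sum_congr rfl fun t ht => permSum_congr fun l₁ h1 => permSum_congr fun l₂ h2 => ?_
  rw [treeOf_append_cons]
  · exact fun x hx => hlt x (Finset.mem_powerset.1 ht ((mem_of_mem_orderings h1).1 hx))
  · exact fun x hx => hlt x (Finset.sdiff_subset ((mem_of_mem_orderings h2).1 hx))

theorem sum_powerset_card_mul (u : Finset ℕ) (f : ℕ → ℕ → ℕ) :
    ∑ t ∈ u.powerset, f t.card (u \ t).card =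
      ∑ i ∈ Finset.range (u.card + 1), u.card.choose i * f i (u.card - i) := by
  have := Finset.sum_powerset_apply_card (fun i => f i (u.card - i)) (x := u)
  simp only [smul_eq_mul] at this
  rw [← this]
  refine Finset.sum_congr rfl fun t ht => ?_
  rw [Finset.card_sdiff_of_subset (Finset.mem_powerset.1 ht)]

theorem treeOf_eq_nil_iff_of_mem {s : Finset ℕ} {l : List ℕ} (h : l ∈ orderings s) :
    treeOf l = BT.nil ↔ s = ∅ := by
  rw [treeOf_eq_nil_iff, ← List.length_eq_zero_iff, length_of_mem_orderings h, Finset.card_eq_zero]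

theorem permSum_emptyOrBal (k : ℕ) : ∀ s : Finset ℕ,
    permSum s (fun l => if emptyOrBal k (treeOf l) then 1 else 0) = emptyOrBalCount k s.card := by
  have h0 : ∀ k, permSum ∅ (fun l => if emptyOrBal k (treeOf l) then 1 else 0) = 1 := fun k => by
    rw [permSum_empty, if_pos (by exact Or.inl rfl)]
  induction k with
  | zero =>
    intro s
    rcases hs : s.card with _ | n
    · obtain rfl := Finset.card_eq_zero.1 hs
      simp [h0, emptyOrBalCount]
    · obtain ⟨m, u, hm, rfl, hu, hlt⟩ := exists_eq_insert_max hs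
      rw [permSum_treeOf_insert hm hlt (fun t => if emptyOrBal 0 t then 1 else 0)]
      have : ∀ t ∈ u.powerset, (permSum t fun l₁ => permSum (u \ t) fun l₂ =>
          if emptyOrBal 0 (BT.node m (treeOf l₁) (treeOf l₂)) then 1 else 0)
          = if u = ∅ then 1 else 0 := by
        intro t ht
        by_cases hu0 : u = ∅
        · subst hu0
          obtain rfl : t = ∅ := by simpa using ht
          simp [permSum_empty, emptyOrBal, treeOf, treeOfAux, balRank]
        · rw [if_neg hu0]
          refine Finset.sum_eq_zero fun l₁ h1 => Finset.sum_eq_zero fun l₂ h2 => ?_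
          rw [if_neg]
          rintro (h | h)
          · cases h
          · rw [balRank_node_zero, treeOf_eq_nil_iff_of_mem h1, treeOf_eq_nil_iff_of_mem h2] at h
            obtain ⟨rfl, h⟩ := h
            simp at h
            exact hu0 h
      rw [Finset.sum_congr rfl this, emptyOrBalCount]
      by_cases hu0 : u = ∅
      · subst hu0
        simp at hu
        simp [← hu]
      · have : n ≠ 0 := by rw [← hu]; simpa using hu0
        simp [hu0, this]
  | succ k ih =>
    intro s
    rcases hs : s.card with _ | n
    · obtain rfl := Finset.card_eq_zero.1 hs
      simp [h0, emptyOrBalCount]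
    · obtain ⟨m, u, hm, rfl, hu, hlt⟩ := exists_eq_insert_max hs
      rw [permSum_treeOf_insert hm hlt (fun t => if emptyOrBal (k + 1) t then 1 else 0),
        emptyOrBalCount]
      split_ifs with hn
      · subst hn
        obtain rfl := Finset.card_eq_zero.1 hu
        simp [permSum_empty, emptyOrBal, treeOf, treeOfAux, balRank]
      · have : ∀ t ∈ u.powerset, (permSum t fun l₁ => permSum (u \ t) fun l₂ =>
            if emptyOrBal (k + 1) (BT.node m (treeOf l₁) (treeOf l₂)) then 1 else 0)
            = emptyOrBalCount k t.card * emptyOrBalCount k (u \ t).card := by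
          intro t ht
          rw [← ih, ← ih, ← permSum_mul]
          refine permSum_congr fun l₁ h1 => permSum_congr fun l₂ h2 => ?_
          have hne : ¬ (treeOf l₁ = BT.nil ∧ treeOf l₂ = BT.nil) := by
            rw [treeOf_eq_nil_iff_of_mem h1, treeOf_eq_nil_iff_of_mem h2]
            rintro ⟨rfl, h⟩
            rw [Finset.sdiff_empty] at h
            rw [h] at hu
            exact hn hu.symm
          have : emptyOrBal (k + 1) (BT.node m (treeOf l₁) (treeOf l₂)) ↔
              emptyOrBal k (treeOf l₁) ∧ emptyOrBal k (treeOf l₂) := by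
            rw [emptyOrBal, balRank_node_succ]
            simp [hne]
          simp only [this, ite_and]
          split_ifs <;> rfl
        rw [Finset.sum_congr rfl this, sum_powerset_card_mul u
          (fun i j => emptyOrBalCount k i * emptyOrBalCount k j), hu]
        simp only [mul_assoc]

/-- The number of decreasing binary trees on `n ≥ 1` labels whose root is balanced. -/
def rootBalCount (n : ℕ) : ℕ := ∑ k ∈ Finset.range n, emptyOrBalCount k n

theorem permSum_isSome {s : Finset ℕ} (hs : s.Nonempty) :
    permSum s (fun l => if (balRank (treeOf l)).isSome then 1 else 0) = rootBalCount s.card := by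
  unfold rootBalCount
  simp_rw [← permSum_emptyOrBal]
  unfold permSum
  rw [Finset.sum_comm]
  refine Finset.sum_congr rfl fun l hl => ?_
  have hnil : treeOf l ≠ BT.nil := by
    rw [Ne, treeOf_eq_nil_iff_of_mem hl]; exact hs.ne_empty
  simp only [emptyOrBal, hnil, false_or]
  rcases h : balRank (treeOf l) with _ | k
  · simp
  · have : k < s.card := by
      rw [← length_of_mem_orderings hl]; exact balRank_treeOfAux_lt _ _ _ h
    simp [this]

theorem permSum_countBalAll_insert {u : Finset ℕ} {m : ℕ} (hm : m ∉ u) (hlt : ∀ x ∈ u, x < m) :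
    permSum (insert m u) (fun l => countBalAll (treeOf l)) =
      ∑ t ∈ u.powerset, (permSum t (fun l => countBalAll (treeOf l)) * (u \ t).card.factorial +
        t.card.factorial * permSum (u \ t) (fun l => countBalAll (treeOf l))) +
      rootBalCount (u.card + 1) := by
  rw [← Finset.card_insert_of_notMem hm, ← permSum_isSome (Finset.insert_nonempty m u),
    permSum_treeOf_insert hm hlt, permSum_treeOf_insert hm hlt
    (fun t => if (balRank t).isSome then 1 else 0), ← Finset.sum_add_distrib]
  refine Finset.sum_congr rfl fun t _ => ?_
  rw [← permSum_one, ← permSum_one, ← permSum_mul, ← permSum_mul, ← permSum_add, ← permSum_add]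
  refine permSum_congr fun l₁ _ => ?_
  rw [← permSum_add, ← permSum_add]
  refine permSum_congr fun l₂ _ => ?_
  simp only [countBalAll, mul_one, one_mul]

theorem permSum_countBalAll (s : Finset ℕ) :
    permSum s (fun l => countBalAll (treeOf l)) = totalBal s.card := by
  rw [totalBal, sum_map_perms]
  induction h : s.card using Nat.strong_induction_on generalizing s with
  | _ N ih =>
  rcases N with _ | n
  · obtain rfl := Finset.card_eq_zero.1 h
    rfl
  · have key : ∀ s : Finset ℕ, s.card = n + 1 → permSum s (fun l => countBalAll (treeOf l)) =
        ∑ i ∈ Finset.range (n + 1), n.choose i *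
          (totalBal i * (n - i).factorial + i.factorial * totalBal (n - i)) +
        rootBalCount (n + 1) := by
      intro s hs
      obtain ⟨m, u, hm, rfl, hu, hlt⟩ := exists_eq_insert_max hs
      rw [permSum_countBalAll_insert hm hlt, hu]
      congr 1
      have := sum_powerset_card_mul u (fun i j => totalBal i * j.factorial +
        i.factorial * totalBal j)
      rw [hu] at this
      rw [← this]
      refine Finset.sum_congr rfl fun t ht => ?_
      have h1 := Finset.card_le_card (Finset.mem_powerset.1 ht)
      have h2 := Finset.card_le_card (Finset.sdiff_subset (s := u) (t := t))
      rw [ih _ (by omega) t rfl, ih _ (by omega) (u \ t) rfl]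
      simp only [totalBal, sum_map_perms]
    rw [key s h, key _ (by simp)]

theorem totalBal_succ (n : ℕ) : totalBal (n + 1) =
    ∑ i ∈ Finset.range (n + 1), n.choose i *
      (totalBal i * (n - i).factorial + i.factorial * totalBal (n - i)) +
    rootBalCount (n + 1) := by
  have h : (Finset.range (n + 1)).card = n + 1 := Finset.card_range _
  obtain ⟨m, u, hm, hs, hu, hlt⟩ := exists_eq_insert_max h
  rw [← h, ← permSum_countBalAll, hs, permSum_countBalAll_insert hm hlt]
  simp_rw [permSum_countBalAll]
  rw [sum_powerset_card_mul u (fun i j => totalBal i * j.factorial +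
        i.factorial * totalBal j), Finset.card_insert_of_notMem hm, hu]

theorem emptyOrBalCount_zero_right (k : ℕ) : emptyOrBalCount k 0 = 1 := by
  cases k <;> rfl

theorem emptyOrBalCount_eq_zero_of_le (k : ℕ) : ∀ n, 1 ≤ n → n ≤ k → emptyOrBalCount k n = 0 := by
  induction k with
  | zero => intro n h1 h2; omega
  | succ k ih =>
    intro n h1 h2
    obtain ⟨n, rfl⟩ := Nat.exists_eq_add_of_le' h1
    rw [emptyOrBalCount]
    split_ifs with hn
    · rfl
    · refine Finset.sum_eq_zero fun i hi => ?_
      rw [Finset.mem_range] at hi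
      rcases Nat.eq_zero_or_pos i with rfl | hi0
      · rw [Nat.sub_zero, ih n (by omega) (by omega), mul_zero]
      · rw [ih i (by omega) (by omega), mul_zero, zero_mul]

theorem emptyOrBalCount_eq_zero_of_ge (k : ℕ) :
    ∀ n, 2 ^ (k + 1) ≤ n → emptyOrBalCount k n = 0 := by
  induction k with
  | zero =>
    intro n h
    obtain ⟨n, rfl⟩ := Nat.exists_eq_add_of_le' h
    simp [emptyOrBalCount]
  | succ k ih =>
    intro n h
    have hp : 2 ^ (k + 1 + 1) = 2 * 2 ^ (k + 1) := by ring
    have hpos : 1 ≤ 2 ^ (k + 1) := Nat.one_le_two_pow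
    obtain ⟨n, rfl⟩ : ∃ m, n = m + 1 := ⟨n - 1, by omega⟩
    rw [emptyOrBalCount]
    split_ifs with hn
    · rfl
    · refine Finset.sum_eq_zero fun i hi => ?_
      rw [Finset.mem_range] at hi
      rcases Nat.lt_or_ge i (2 ^ (k + 1)) with h' | h'
      · rw [ih (n - i) (by omega), mul_zero]
      · rw [ih i h', mul_zero, zero_mul]

/-- The probability that a tree on `n` labels is empty or has a balanced root of rank `k`. -/
def rankProb (k n : ℕ) : ℚ := emptyOrBalCount k n / n.factorial

/-- The probability that the root of a tree on `n` labels is balanced. -/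
def rootProb (n : ℕ) : ℚ := rootBalCount n / n.factorial

/-- The expected number of balanced vertices of a tree on `n` labels. -/
def meanBal (n : ℕ) : ℚ := totalBal n / n.factorial

theorem rankProb_nonneg (k n : ℕ) : 0 ≤ rankProb k n := by unfold rankProb; positivity

theorem rootProb_nonneg (n : ℕ) : 0 ≤ rootProb n := by unfold rootProb; positivity

theorem rankProb_zero_right (k : ℕ) : rankProb k 0 = 1 := by
  simp [rankProb, emptyOrBalCount_zero_right]

theorem rankProb_eq_zero_of_le {k n : ℕ} (h1 : 1 ≤ n) (h2 : n ≤ k) : rankProb k n = 0 := by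
  simp [rankProb, emptyOrBalCount_eq_zero_of_le k n h1 h2]

theorem rankProb_eq_zero_of_ge {k n : ℕ} (h : 2 ^ (k + 1) ≤ n) : rankProb k n = 0 := by
  simp [rankProb, emptyOrBalCount_eq_zero_of_ge k n h]

theorem rootProb_eq_sum (n : ℕ) : rootProb n = ∑ k ∈ Finset.range n, rankProb k n := by
  simp only [rootProb, rankProb, rootBalCount, Nat.cast_sum, Finset.sum_div]

theorem rootProb_eq_sum_of_le {n N : ℕ} (h1 : 1 ≤ n) (h : n ≤ N) :
    rootProb n = ∑ k ∈ Finset.range N, rankProb k n := by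
  rw [rootProb_eq_sum]
  refine Finset.sum_subset (Finset.range_mono h) fun k _ hk => ?_
  exact rankProb_eq_zero_of_le h1 (by simpa using hk)

theorem rankProb_le_rootProb {k n : ℕ} (hn : 1 ≤ n) : rankProb k n ≤ rootProb n := by
  rcases Nat.lt_or_ge k n with h | h
  · rw [rootProb_eq_sum]
    exact Finset.single_le_sum (f := fun k => rankProb k n) (fun k _ => rankProb_nonneg k n)
      (Finset.mem_range.2 h)
  · rw [rankProb_eq_zero_of_le hn h]
    exact rootProb_nonneg n

theorem succ_mul_rankProb_succ {k n : ℕ} (hn : 1 ≤ n) : (n + 1 : ℚ) * rankProb (k + 1) (n + 1) =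
    ∑ i ∈ Finset.range (n + 1), rankProb k i * rankProb k (n - i) := by
  have hn0 : n ≠ 0 := by omega
  rw [rankProb, emptyOrBalCount, if_neg hn0, Nat.factorial_succ, Nat.cast_sum, Finset.sum_div,
    Finset.mul_sum]
  refine Finset.sum_congr rfl fun i hi => ?_
  have hi' : i ≤ n := Nat.lt_succ_iff.1 (Finset.mem_range.1 hi)
  have hf : (n.choose i : ℚ) * i.factorial * (n - i).factorial = n.factorial := by
    exact_mod_cast Nat.choose_mul_factorial_mul_factorial hi'
  have h1 : (i.factorial : ℚ) ≠ 0 := by positivity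
  have h2 : ((n - i).factorial : ℚ) ≠ 0 := by positivity
  have h3 : (n.factorial : ℚ) ≠ 0 := by positivity
  have h4 : (n + 1 : ℚ) ≠ 0 := by positivity
  rw [rankProb, rankProb]
  push_cast
  field_simp
  rw [← hf]
  ring

theorem succ_mul_rootProb_succ {n : ℕ} (hn : 1 ≤ n) : (n + 1 : ℚ) * rootProb (n + 1) =
    ∑ i ∈ Finset.range (n + 1), ∑ k ∈ Finset.range n, rankProb k i * rankProb k (n - i) := by
  have h0 : rankProb 0 (n + 1) = 0 := rankProb_eq_zero_of_ge (by omega)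
  rw [rootProb_eq_sum, Finset.sum_range_succ', h0, add_zero, Finset.mul_sum, Finset.sum_comm]
  exact Finset.sum_congr rfl fun k _ => succ_mul_rankProb_succ hn

theorem sum_rankProb_mul_le {i j N : ℕ} (hi : 1 ≤ i) (hj : 1 ≤ j) (hN : i ≤ N) :
    ∑ k ∈ Finset.range N, rankProb k i * rankProb k j ≤ rootProb i * rootProb j := by
  rw [rootProb_eq_sum_of_le hi hN, Finset.sum_mul]
  exact Finset.sum_le_sum fun k _ =>
    mul_le_mul_of_nonneg_left (rankProb_le_rootProb hj) (rankProb_nonneg k i)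

theorem sum_rankProb_mul_eq_zero {i j N : ℕ} (hi : 1 ≤ i) (hi' : i ≤ 3) (hj : 8 ≤ j) :
    ∑ k ∈ Finset.range N, rankProb k i * rankProb k j = 0 := by
  refine Finset.sum_eq_zero fun k _ => ?_
  rcases Nat.lt_or_ge k i with h | h
  · have : 2 ^ (k + 1) ≤ 2 ^ 3 := Nat.pow_le_pow_right (by norm_num) (by omega)
    rw [rankProb_eq_zero_of_ge (n := j) (by omega), mul_zero]
  · rw [rankProb_eq_zero_of_le hi h, zero_mul]

theorem rootBalCount_le_of_small : ∀ i < 8,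
    rootBalCount (i + 4) * 1000 ^ (i + 5) ≤ 871 ^ (i + 5) * (i + 4).factorial := by
  decide +kernel

theorem sum_range_add_nine (c : ℕ → ℚ) (m : ℕ) : ∑ i ∈ Finset.range (m + 9), c i =
    c 0 + c 1 + c 2 + c 3 + ∑ i ∈ Finset.range (m + 1), c (i + 4) +
      (c (m + 8 - 3) + c (m + 8 - 2) + c (m + 8 - 1) + c (m + 8 - 0)) := by
  have h : ∑ i ∈ Finset.range (m + 1 + 4), c i =
      c 0 + c 1 + c 2 + c 3 + ∑ i ∈ Finset.range (m + 1), c (i + 4) := by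
    have h4 : ∑ i ∈ Finset.range 4, c i = c 0 + c 1 + c 2 + c 3 := by
      simp [Finset.sum_range_succ]
    rw [add_comm (m + 1) 4, Finset.sum_range_add, h4]
    simp only [add_comm]
  have hsucc (N : ℕ) : ∑ i ∈ Finset.range (N + 1 + 1 + 1 + 1), c i =
      ∑ i ∈ Finset.range N, c i + (c N + c (N + 1) + c (N + 1 + 1) + c (N + 1 + 1 + 1)) := by
    simp only [Finset.sum_range_succ]
    ring
  rw [← h, show m + 8 - 3 = m + 1 + 4 by omega, show m + 8 - 2 = m + 1 + 4 + 1 by omega,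
    show m + 8 - 1 = m + 1 + 4 + 1 + 1 by omega, show m + 8 - 0 = m + 1 + 4 + 1 + 1 + 1 by omega,
    ← hsucc]

theorem rootProb_le_pow (n : ℕ) (hn : 4 ≤ n) : rootProb n ≤ (871 / 1000) ^ (n + 1) := by
  induction n using Nat.strong_induction_on with
  | _ n ih =>
  rcases Nat.lt_or_ge n 12 with h12 | h12
  · obtain ⟨i, rfl⟩ := Nat.exists_eq_add_of_le' hn
    have h : ((rootBalCount (i + 4) * 1000 ^ (i + 5) : ℕ) : ℚ) ≤
        (871 ^ (i + 5) * (i + 4).factorial : ℕ) := by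
      exact_mod_cast rootBalCount_le_of_small i (by omega)
    push_cast at h
    rw [rootProb, div_pow, div_le_div_iff₀ (by positivity) (by positivity)]
    exact h
  · obtain ⟨m, rfl⟩ := Nat.exists_eq_add_of_le' (show 9 ≤ n by omega)
    have hrec := succ_mul_rootProb_succ (n := m + 8) (by omega)
    set c : ℕ → ℚ := fun i =>
      ∑ k ∈ Finset.range (m + 8), rankProb k i * rankProb k (m + 8 - i) with hc
    have hsymm : ∀ i ≤ m + 8, c (m + 8 - i) = c i := fun i hi => by
      simp only [hc, Nat.sub_sub_self hi, mul_comm]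
    have c0 : c 0 = rootProb (m + 8) := by
      simp only [hc, rankProb_zero_right, one_mul, Nat.sub_zero, ← rootProb_eq_sum]
    have hsmall : ∀ i, 1 ≤ i → i ≤ 3 → c i = 0 := fun i h1 h3 =>
      sum_rankProb_mul_eq_zero h1 h3 (by omega)
    have hmid : ∀ i ∈ Finset.range (m + 1), c (i + 4) ≤ (871 / 1000) ^ (m + 10) := by
      intro i hi
      rw [Finset.mem_range] at hi
      calc c (i + 4) ≤ rootProb (i + 4) * rootProb (m + 8 - (i + 4)) :=
            sum_rankProb_mul_le (by omega) (by omega) (by omega)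
        _ ≤ (871 / 1000) ^ (i + 4 + 1) * (871 / 1000) ^ (m + 8 - (i + 4) + 1) :=
            mul_le_mul (ih _ (by omega) (by omega)) (ih _ (by omega) (by omega))
              (rootProb_nonneg _) (by positivity)
        _ = (871 / 1000) ^ (m + 10) := by
            rw [← pow_add]; congr 1; omega
    have hsum : ∑ i ∈ Finset.range (m + 9), c i =
        2 * rootProb (m + 8) + ∑ i ∈ Finset.range (m + 1), c (i + 4) := by
      rw [sum_range_add_nine, hsymm 0 (by omega), hsymm 1 (by omega), hsymm 2 (by omega),
        hsymm 3 (by omega), hsmall 1 (by omega) (by omega), hsmall 2 (by omega) (by omega),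
        hsmall 3 (by omega) (by omega), c0]
      ring
    have hle : ∑ i ∈ Finset.range (m + 1), c (i + 4) ≤ (m + 1) * (871 / 1000) ^ (m + 10) := by
      refine (Finset.sum_le_sum hmid).trans ?_
      simp
    have hq := ih (m + 8) (by omega) (by omega)
    rw [hsum] at hrec
    push_cast at hrec
    have hp : (871 / 1000 : ℚ) ^ (m + 10) = (871 / 1000) * (871 / 1000) ^ (m + 8 + 1) := by
      rw [← pow_succ']
    have hpos : (0 : ℚ) < (871 / 1000) ^ (m + 8 + 1) := by positivity
    have hm : (0 : ℚ) < m + 8 + 1 := by positivity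
    refine le_of_mul_le_mul_left ?_ hm
    rw [show m + 9 + 1 = m + 10 by omega]
    rw [show m + 9 = m + 8 + 1 by omega, hrec]
    nlinarith

theorem rootBalCount_step_of_small : ∀ i < 30, 3 * (i + 4) * rootBalCount (i + 4) ≤
    (i + 4).factorial + 3 * (i + 3) * (i + 4) * rootBalCount (i + 3) := by
  decide +kernel

theorem mul_pow_le (n : ℕ) (hn : 34 ≤ n) : (n : ℚ) * (871 / 1000) ^ (n + 1) ≤ 1 / 3 := by
  induction n, hn using Nat.le_induction with
  | base => norm_num
  | succ n hn ih =>
    have hn' : (34 : ℚ) ≤ n := by exact_mod_cast hn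
    have hpos : (0 : ℚ) < (871 / 1000) ^ (n + 1) := by positivity
    rw [pow_succ]
    push_cast
    nlinarith

theorem succ_mul_rootProb_le (n : ℕ) (hn : 3 ≤ n) :
    (n + 1 : ℚ) * rootProb (n + 1) ≤ n * rootProb n + 1 / 3 := by
  rcases Nat.lt_or_ge n 33 with h | h
  · obtain ⟨i, rfl⟩ := Nat.exists_eq_add_of_le' hn
    have h : ((3 * (i + 4) * rootBalCount (i + 4) : ℕ) : ℚ) ≤
        ((i + 4).factorial + 3 * (i + 3) * (i + 4) * rootBalCount (i + 3) : ℕ) := by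
      exact_mod_cast rootBalCount_step_of_small i (by omega)
    have hf : ((i + 4).factorial : ℚ) = (i + 4) * (i + 3).factorial := by
      rw [Nat.factorial_succ]; push_cast; ring
    have h3 : (0 : ℚ) < (i + 3).factorial := by positivity
    rw [rootProb, rootProb, show i + 3 + 1 = i + 4 by omega]
    push_cast at h ⊢
    rw [hf] at h ⊢
    have h4 : (0 : ℚ) < i + 4 := by positivity
    field_simp
    nlinarith
  · have h1 := rootProb_le_pow (n + 1) (by omega)
    have h2 := mul_pow_le (n + 1) (by omega)
    have h3 : 0 ≤ (n : ℚ) * rootProb n := mul_nonneg (by positivity) (rootProb_nonneg n)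
    push_cast at h2
    nlinarith

theorem succ_mul_meanBal_succ (n : ℕ) : (n + 1 : ℚ) * meanBal (n + 1) =
    2 * ∑ i ∈ Finset.range (n + 1), meanBal i + (n + 1) * rootProb (n + 1) := by
  have hsum : ∑ i ∈ Finset.range (n + 1), (meanBal i + meanBal (n - i)) =
      2 * ∑ i ∈ Finset.range (n + 1), meanBal i := by
    have := Finset.sum_range_reflect meanBal (n + 1)
    simp only [Nat.add_sub_cancel] at this
    rw [Finset.sum_add_distrib, this, two_mul]
  rw [← hsum, meanBal, totalBal_succ, rootProb, Nat.factorial_succ, Nat.cast_add, add_div, mul_add]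
  congr 1
  rw [Nat.cast_sum, Finset.sum_div, Finset.mul_sum]
  refine Finset.sum_congr rfl fun i hi => ?_
  have hi' : i ≤ n := Nat.lt_succ_iff.1 (Finset.mem_range.1 hi)
  have hf : (n.choose i : ℚ) * i.factorial * (n - i).factorial = n.factorial := by
    exact_mod_cast Nat.choose_mul_factorial_mul_factorial hi'
  have h1 : (i.factorial : ℚ) ≠ 0 := by positivity
  have h2 : ((n - i).factorial : ℚ) ≠ 0 := by positivity
  have h3 : (n.factorial : ℚ) ≠ 0 := by positivity
  have h4 : (n + 1 : ℚ) ≠ 0 := by positivity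
  rw [meanBal, meanBal]
  push_cast
  field_simp
  rw [← hf]
  ring

theorem meanBal_recurrence (n : ℕ) : (n + 2 : ℚ) * meanBal (n + 2) =
    (n + 3) * meanBal (n + 1) + ((n + 2) * rootProb (n + 2) - (n + 1) * rootProb (n + 1)) := by
  have h1 := succ_mul_meanBal_succ n
  have h2 := succ_mul_meanBal_succ (n + 1)
  rw [Finset.sum_range_succ] at h2
  push_cast at h2
  rw [show (n : ℚ) + 1 + 1 = n + 2 by ring, show n + 1 + 1 = n + 2 by omega] at h2
  linarith

theorem meanBal_zero : meanBal 0 = 0 := by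
  simp [meanBal, totalBal, perms, treeOf, treeOfAux, countBalAll]

theorem rootProb_one : rootProb 1 = 1 := by
  rw [rootProb, show rootBalCount 1 = 1 by decide +kernel]; simp

theorem rootProb_two : rootProb 2 = 1 := by
  rw [rootProb, show rootBalCount 2 = 2 by decide +kernel]; simp

theorem rootProb_three : rootProb 3 = 1 := by
  rw [rootProb, show rootBalCount 3 = 6 by decide +kernel]; simp [Nat.factorial]

theorem meanBal_one : meanBal 1 = 1 := by
  have h := succ_mul_meanBal_succ 0
  simpa [meanBal_zero, rootProb_one] using h

theorem meanBal_two : meanBal 2 = 2 := by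
  have h := meanBal_recurrence 0
  norm_num [meanBal_one, rootProb_one, rootProb_two] at h
  linarith

theorem le_sum_meanBal (n : ℕ) (hn : 2 ≤ n) :
    (n * (n + 1) / 6 : ℚ) ≤ ∑ i ∈ Finset.range n, meanBal i := by
  induction n, hn using Nat.le_induction with
  | base => norm_num [Finset.sum_range_succ, meanBal_zero, meanBal_one]
  | succ n hn ih =>
    obtain ⟨n, rfl⟩ := Nat.exists_eq_add_of_le' (show 1 ≤ n by omega)
    have h := succ_mul_meanBal_succ n
    have hq := mul_nonneg (show (0 : ℚ) ≤ n + 1 by positivity) (rootProb_nonneg (n + 1))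
    have hpos : (0 : ℚ) < n + 1 := by positivity
    rw [Finset.sum_range_succ]
    push_cast at ih ⊢
    have : ((n : ℚ) + 2) / 3 ≤ meanBal (n + 1) := by
      refine le_of_mul_le_mul_left ?_ hpos
      rw [h]
      linarith
    linarith

theorem le_meanBal (n : ℕ) (hn : 1 ≤ n) : (n / 3 : ℚ) ≤ meanBal n := by
  obtain ⟨n, rfl⟩ := Nat.exists_eq_add_of_le' hn
  rcases Nat.eq_zero_or_pos n with rfl | hn'
  · norm_num [meanBal_one]
  · have h := succ_mul_meanBal_succ n
    have hS := le_sum_meanBal (n + 1) (by omega)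
    have hq := mul_nonneg (show (0 : ℚ) ≤ n + 1 by positivity) (rootProb_nonneg (n + 1))
    have hpos : (0 : ℚ) < n + 1 := by positivity
    push_cast at hS ⊢
    refine le_of_mul_le_mul_left ?_ hpos
    rw [h]
    nlinarith

theorem mul_rootProb_diff_le_meanBal (n : ℕ) (hn : 1 ≤ n) :
    n * ((n + 1) * rootProb (n + 1) - n * rootProb n) ≤ meanBal n := by
  rcases Nat.lt_or_ge n 3 with h | h
  · interval_cases n
    · norm_num [rootProb_one, rootProb_two, meanBal_one]
    · norm_num [rootProb_two, rootProb_three, meanBal_two]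
  · have h1 := succ_mul_rootProb_le n h
    have h2 := le_meanBal n hn
    have h3 : (0 : ℚ) ≤ n := by positivity
    nlinarith

end BalancedTrees

/-- The sequence `P(1), P(2), P(3), …` is weakly decreasing: for every
`n ≥ 1`, `P(n+1) ≤ P(n)`, where `P(n)` is the probability that a vertex
chosen uniformly at random from the `n·n!` vertices of all decreasing binary
trees on `{1,…,n}` is balanced. -/
theorem statement7 (n : ℕ) (hn : 1 ≤ n) : Pbal (n + 1) ≤ Pbal n := by
  have hP : ∀ n, Pbal n = meanBal n / n := fun n => by
    rw [Pbal, meanBal, div_div, mul_comm]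
  have h := mul_rootProb_diff_le_meanBal n hn
  rw [hP, hP]
  obtain ⟨n, rfl⟩ := Nat.exists_eq_add_of_le' hn
  have hrec := meanBal_recurrence n
  have h2 : (0 : ℚ) < n + 2 := by positivity
  rw [div_le_div_iff₀ (by positivity) (by positivity)]
  push_cast at h ⊢
  rw [show n + 1 + 1 = n + 2 by omega, show (n : ℚ) + 1 + 1 = n + 2 by ring] at *
  refine le_of_mul_le_mul_left ?_ h2
  nlinarith
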